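/- arXiv:2604.27802 — 2 statements merged into one kernel-verified Lean document; each statement's English description precedes it below -/
import Mathlib

section
/- For every finite undirected graph G with maximum degree Δ(G), the cutwidth of G is at most Δ(G) · (pw(G) + 1), where pw(G) is the pathwidth of G. -/
/-- `G` has a path decomposition of width at most `k`: a sequence of bags `B 0, …, B (n-1)`
covering all vertices and all edges, such that the bags containing any fixed vertex form an
interval, and every bag has at most `k + 1` vertices. -/
def HasPathDecompWidth {V : Type*} (G : SimpleGraph V) (k : ℕ) : Prop :=
  ∃ (n : ℕ) (B : Fin n → Finset V),
    (∀ v : V, ∃ i, v ∈ B i) ∧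
    (∀ u v : V, G.Adj u v → ∃ i, u ∈ B i ∧ v ∈ B i) ∧
    (∀ (v : V) (i j l : Fin n), i ≤ j → j ≤ l → v ∈ B i → v ∈ B l → v ∈ B j) ∧
    (∀ i, (B i).card ≤ k + 1)

/-- The pathwidth of `G`: the minimum width of a path decomposition of `G`. -/
noncomputable def pathwidth {V : Type*} (G : SimpleGraph V) : ℕ :=
  sInf {k | HasPathDecompWidth G k}

/-- The number of edges of `G` crossing the cut after position `i` in the linear
layout `σ` (each crossing edge is counted once, via its left-to-right orientation). -/
def cutAt {V : Type*} [Fintype V] [DecidableEq V] (G : SimpleGraph V)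
    [DecidableRel G.Adj] (σ : V ≃ Fin (Fintype.card V)) (i : ℕ) : ℕ :=
  (Finset.univ.filter fun q : V × V =>
    G.Adj q.1 q.2 ∧ (σ q.1 : ℕ) ≤ i ∧ i < (σ q.2 : ℕ)).card

/-- The cutwidth of `G`: the minimum over all linear layouts of the maximum number of
edges crossing a cut of the layout. -/
noncomputable def cutwidth {V : Type*} [Fintype V] [DecidableEq V] (G : SimpleGraph V)
    [DecidableRel G.Adj] : ℕ :=
  sInf {k | ∃ σ : V ≃ Fin (Fintype.card V), ∀ i : ℕ, cutAt G σ i ≤ k}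

/-- Every function from a finite type to a linear order is monotone along some linear layout. -/
theorem exists_layout_le_of_le {V α : Type*} [Fintype V] [LinearOrder α] (f : V → α) :
    ∃ σ : V ≃ Fin (Fintype.card V), ∀ u v, σ u ≤ σ v → f u ≤ f v := by
  let e := Fintype.equivFin V
  let s := Tuple.sort (f ∘ e.symm)
  refine ⟨e.trans s.symm, fun u v h => ?_⟩
  simpa [s] using Tuple.monotone_sort (f ∘ e.symm) h

/-- Taking all vertices as a single bag yields a path decomposition. -/
theorem hasPathDecompWidth_card {V : Type*} [Fintype V] (G : SimpleGraph V) :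
    HasPathDecompWidth G (Fintype.card V) :=
  ⟨1, fun _ => Finset.univ, fun _ => ⟨0, Finset.mem_univ _⟩,
    fun _ _ _ => ⟨0, Finset.mem_univ _, Finset.mem_univ _⟩,
    fun _ _ _ _ _ _ _ _ => Finset.mem_univ _, fun _ => Nat.le_succ _⟩

theorem hasPathDecompWidth_pathwidth {V : Type*} [Fintype V] (G : SimpleGraph V) :
    HasPathDecompWidth G (pathwidth G) :=
  Nat.sInf_mem (s := {k | HasPathDecompWidth G k}) ⟨_, hasPathDecompWidth_card G⟩

/-- The number of ordered adjacent pairs starting in `S` is at most `Δ(G) * |S|`. -/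
theorem card_filter_adj_fst_mem_le {V : Type*} [Fintype V] [DecidableEq V] (G : SimpleGraph V)
    [DecidableRel G.Adj] (S : Finset V) :
    (Finset.univ.filter fun q : V × V => G.Adj q.1 q.2 ∧ q.1 ∈ S).card ≤
      G.maxDegree * S.card := by
  refine Finset.card_le_mul_card_image_of_maps_to (f := Prod.fst) (t := S)
    (fun q hq => (Finset.mem_filter.mp hq).2.2) _ fun u _ => ?_
  refine le_trans ?_ (G.degree_le_maxDegree u)
  rw [← G.card_neighborFinset_eq_degree]
  refine Finset.card_le_card_of_injOn Prod.snd (fun q hq => ?_) fun p hp q hq h => ?_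
  · simp only [Finset.coe_filter, Finset.mem_filter, Finset.mem_univ, true_and,
      Set.mem_ofPred_eq] at hq
    simpa [← hq.2] using hq.1.1
  · simp only [Finset.coe_filter, Finset.mem_filter, Finset.mem_univ, true_and,
      Set.mem_ofPred_eq] at hp hq
    exact Prod.ext (hp.2.trans hq.2.symm) h

/-- Ordering the vertices by the first bag containing them gives a layout of small width. -/
theorem HasPathDecompWidth.cutwidth_le {V : Type*} [Fintype V] [DecidableEq V]
    {G : SimpleGraph V} [DecidableRel G.Adj] {k : ℕ} (h : HasPathDecompWidth G k) :
    cutwidth G ≤ G.maxDegree * (k + 1) := by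
  obtain ⟨n, B, hcover, hedge, hinterval, hcard⟩ := h
  have hfirst : ∀ v, ∃ i, v ∈ B i ∧ ∀ j, v ∈ B j → i ≤ j := fun v => by
    obtain ⟨i, hi⟩ := hcover v
    obtain ⟨m, hm, hmin⟩ := (Finset.univ.filter fun i => v ∈ B i).exists_min_image id
      ⟨i, by simpa using hi⟩
    exact ⟨m, by simpa using hm, fun j hj => hmin j (by simpa using hj)⟩
  choose f hf hfmin using hfirst
  obtain ⟨σ, hσ⟩ := exists_layout_le_of_le f
  refine Nat.sInf_le ⟨σ, fun i => ?_⟩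
  by_cases hi : i < Fintype.card V
  · let b := f (σ.symm ⟨i, hi⟩)
    refine le_trans (Finset.card_le_card fun q hq => ?_)
      ((card_filter_adj_fst_mem_le G (B b)).trans (Nat.mul_le_mul_left _ (hcard b)))
    simp only [Finset.mem_filter, Finset.mem_univ, true_and] at hq ⊢
    obtain ⟨hadj, hle, hlt⟩ := hq
    obtain ⟨j, hj₁, hj₂⟩ := hedge _ _ hadj
    have h₁ : f q.1 ≤ b := hσ _ _ (by simpa [Fin.le_def] using hle)
    have h₂ : b ≤ f q.2 := hσ _ _ (by simpa [Fin.le_def] using hlt.le)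
    exact ⟨hadj, hinterval _ _ _ _ h₁ (h₂.trans (hfmin _ _ hj₂)) (hf _) hj₁⟩
  · refine (Finset.card_eq_zero.mpr (Finset.filter_eq_empty_iff.mpr ?_)).trans_le (Nat.zero_le _)
    rintro q - ⟨-, -, hlt⟩
    exact hi (hlt.trans (σ q.2).isLt)

/-- The cutwidth of a finite graph is at most its maximum degree times
(its pathwidth plus one). -/
theorem cutwidth_le_maxDegree_mul_pathwidth_succ {V : Type*} [Fintype V] [DecidableEq V]
    (G : SimpleGraph V) [DecidableRel G.Adj] :
    cutwidth G ≤ G.maxDegree * (pathwidth G + 1) :=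
  (hasPathDecompWidth_pathwidth G).cutwidth_le
end

section
/- Let M be a directed graph on a finite vertex set V with nonnegative integer edge weights w_M, let s_1, …, s_k ∈ V be the initial positions of k tokens (a multiset S), let t_1, …, t_m ∈ V with m ≤ k be a target configuration T (a multiset), and let b ∈ ℕ. Then there exists a discovery sequence from S of total cost at most b reaching a configuration S' with T ⊆ S' (as multisets) if and only if there exists an injective map σ : {1, …, m} → {1, …, k} such that ∑_{i=1}^{m} dist_M(s_{σ(i)}, t_i) ≤ b, where dist_M denotes shortest-path distance in M (and dist_M(v,v) = 0). Equivalently, T can be realized from S within budget b if and only if the complete bipartite graph between S and T with edge weights dist_M(u, v) admits a matching saturating T of total weight at most b. -/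
/-- `Reach E w S c S'` : configuration `S'` (a multiset of token positions) is reachable
from configuration `S` by a discovery sequence of single token moves along edges of the
movement graph `E` with total movement cost `c`. -/
inductive Reach {V : Type*} [DecidableEq V] (E : V → V → Prop) (w : V → V → ℕ) :
    Multiset V → ℕ → Multiset V → Prop
  | refl (S : Multiset V) : Reach E w S 0 S
  | step {S : Multiset V} {c : ℕ} {S' : Multiset V} (x y : V) :
      x ∈ S → E x y → Reach E w (S.erase x + {y}) c S' → Reach E w S (w x y + c) S'

/-- The shortest-path distance from `u` to `v` in the movement graph: the minimum total
weight of a directed `u`-`v` path, with `distM u u = 0` and value `⊤` if `v` is not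
reachable from `u`. -/
noncomputable def distM {V : Type*} (E : V → V → Prop) (w : V → V → ℕ) (u v : V) : ℕ∞ :=
  sInf ((fun p => ((((p.zip p.tail).map fun q => w q.1 q.2).sum : ℕ) : ℕ∞)) ''
    {p : List V | p.Chain' E ∧ p.head? = some u ∧ p.getLast? = some v ∧ p.Nodup})

/-- The total weight of the consecutive pairs of a list of vertices. -/
def pathWeight {V : Type*} (w : V → V → ℕ) (p : List V) : ℕ :=
  ((p.zip p.tail).map fun q => w q.1 q.2).sum

theorem pathWeight_cons_cons {V : Type*} (w : V → V → ℕ) (a b : V) (l : List V) :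
    pathWeight w (a :: b :: l) = w a b + pathWeight w (b :: l) := by
  simp [pathWeight]

theorem pathWeight_le_cons {V : Type*} (w : V → V → ℕ) (a : V) (l : List V) :
    pathWeight w l ≤ pathWeight w (a :: l) := by
  cases l with
  | nil => simp [pathWeight]
  | cons b l => rw [pathWeight_cons_cons]; exact Nat.le_add_left _ _

theorem pathWeight_le_append {V : Type*} (w : V → V → ℕ) (l₁ l₂ : List V) :
    pathWeight w l₂ ≤ pathWeight w (l₁ ++ l₂) := by
  induction l₁ with
  | nil => exact le_rfl
  | cons a l ih => exact ih.trans (pathWeight_le_cons w a (l ++ l₂))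

theorem distM_le_pathWeight {V : Type*} {E : V → V → Prop} (w : V → V → ℕ) {u v : V} {p : List V}
    (hp : p.IsChain E) (hu : p.head? = some u) (hv : p.getLast? = some v) (hn : p.Nodup) :
    distM E w u v ≤ (pathWeight w p : ℕ∞) :=
  sInf_le ⟨p, ⟨hp, hu, hv, hn⟩, rfl⟩

theorem exists_pathWeight_eq_distM {V : Type*} {E : V → V → Prop} {w : V → V → ℕ} {u v : V}
    (h : distM E w u v ≠ ⊤) :
    ∃ p : List V, p.IsChain E ∧ p.head? = some u ∧ p.getLast? = some v ∧ p.Nodup ∧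
      distM E w u v = (pathWeight w p : ℕ∞) := by
  have hne : ((fun p => ((((p.zip p.tail).map fun q => w q.1 q.2).sum : ℕ) : ℕ∞)) ''
      {p : List V | p.IsChain E ∧ p.head? = some u ∧ p.getLast? = some v ∧ p.Nodup}).Nonempty := by
    by_contra hc
    rw [Set.not_nonempty_iff_eq_empty] at hc
    exact h ((congrArg sInf hc).trans sInf_empty)
  obtain ⟨p, ⟨h₁, h₂, h₃, h₄⟩, h₅⟩ := csInf_mem hne
  exact ⟨p, h₁, h₂, h₃, h₄, h₅.symm⟩

theorem distM_self {V : Type*} (E : V → V → Prop) (w : V → V → ℕ) (v : V) :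
    distM E w v v = 0 := by
  have h := distM_le_pathWeight (E := E) w (p := [v]) (u := v) (v := v)
    (by simp) rfl rfl (by simp)
  simpa [pathWeight] using h

theorem distM_le_add_of_edge {V : Type*} {E : V → V → Prop} (w : V → V → ℕ) {x y : V}
    (hxy : E x y) (v : V) : distM E w x v ≤ (w x y : ℕ∞) + distM E w y v := by
  by_cases htop : distM E w y v = ⊤
  · simp [htop]
  obtain ⟨p, hp, hy, hv, hn, hd⟩ := exists_pathWeight_eq_distM htop
  rw [hd]
  by_cases hx : x ∈ p
  · obtain ⟨l₁, l₂, rfl⟩ := List.append_of_mem hx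
    have hsuf : x :: l₂ <:+ l₁ ++ x :: l₂ := List.suffix_append _ _
    have hle := distM_le_pathWeight (E := E) w (p := x :: l₂) (u := x) (v := v)
      (hp.suffix hsuf) rfl (by simpa using hv) (hn.sublist hsuf.sublist)
    refine hle.trans (le_trans ?_ le_add_self)
    exact_mod_cast pathWeight_le_append w l₁ (x :: l₂)
  · cases p with
    | nil => simp at hy
    | cons a l =>
      obtain rfl : a = y := by simpa using hy
      have hle := distM_le_pathWeight (E := E) w (p := x :: a :: l) (u := x) (v := v)
        (by simpa using ⟨hxy, hp⟩) rfl (by simpa using hv) (List.nodup_cons.2 ⟨hx, hn⟩)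
      rw [pathWeight_cons_cons] at hle
      exact_mod_cast hle

namespace Reach

variable {V : Type*} [DecidableEq V] {E : V → V → Prop} {w : V → V → ℕ}

theorem trans {S T U : Multiset V} {c d : ℕ} (h₁ : Reach E w S c T) (h₂ : Reach E w T d U) :
    Reach E w S (c + d) U := by
  induction h₁ with
  | refl S => simpa using h₂
  | step x y hx hxy _ ih =>
    rw [add_assoc]
    exact step x y hx hxy (ih h₂)

theorem of_path {u v : V} (S : Multiset V) {p : List V} (hp : p.IsChain E)
    (hu : p.head? = some u) (hv : p.getLast? = some v) :
    Reach E w (u ::ₘ S) (pathWeight w p) (v ::ₘ S) := by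
  induction p generalizing u with
  | nil => simp at hu
  | cons a l ih =>
    obtain rfl : a = u := by simpa using hu
    cases l with
    | nil =>
      obtain rfl : a = v := by simpa using hv
      exact refl _
    | cons b l =>
      rw [List.isChain_cons_cons] at hp
      rw [pathWeight_cons_cons]
      refine step a b (Multiset.mem_cons_self a S) hp.1 ?_
      rw [Multiset.erase_cons_head, add_comm, Multiset.singleton_add]
      exact ih hp.2 rfl (by simpa using hv)

theorem exists_of_distM_ne_top {u v : V} (h : distM E w u v ≠ ⊤) :
    ∃ c : ℕ, distM E w u v = c ∧ ∀ S, Reach E w (u ::ₘ S) c (v ::ₘ S) := by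
  obtain ⟨p, hp, hu, hv, -, hd⟩ := exists_pathWeight_eq_distM h
  exact ⟨_, hd, fun S => of_path S hp hu hv⟩

theorem map_add {ι : Type*} (f g : ι → V) (c : ι → ℕ)
    (h : ∀ i S, Reach E w (f i ::ₘ S) (c i) (g i ::ₘ S)) (F : Finset ι) (R : Multiset V) :
    Reach E w (F.val.map f + R) (∑ i ∈ F, c i) (F.val.map g + R) := by
  classical
  induction F using Finset.induction_on generalizing R with
  | empty => exact refl _
  | insert a F ha ih =>
    rw [Finset.sum_insert ha, Finset.insert_val_of_notMem ha]
    simp only [Multiset.map_cons, Multiset.cons_add]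
    refine (h a _).trans ?_
    rw [← Multiset.add_cons, ← Multiset.add_cons]
    exact ih _

theorem exists_map_eq {ι : Type*} [Fintype ι] {S S' : Multiset V} {c : ℕ}
    (h : Reach E w S c S') (f : ι → V) (hf : S = Finset.univ.val.map f) :
    ∃ g : ι → V, S' = Finset.univ.val.map g ∧ ∑ i, distM E w (f i) (g i) ≤ (c : ℕ∞) := by
  classical
  induction h generalizing f with
  | refl S => exact ⟨f, hf, by simp [distM_self]⟩
  | @step S c S' x y hx hxy _ ih =>
    subst hf
    obtain ⟨i, -, rfl⟩ := Multiset.mem_map.1 hx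
    have hrest (a : V) : Finset.univ.val.map (Function.update f i a) =
        a ::ₘ (Finset.univ.erase i).val.map f := by
      rw [← Finset.insert_erase (Finset.mem_univ i),
        Finset.insert_val_of_notMem (Finset.notMem_erase i _), Multiset.map_cons,
        Function.update_self, Finset.insert_erase (Finset.mem_univ i)]
      congr 1
      refine Multiset.map_congr rfl fun j hj => Function.update_of_ne ?_ _ _
      exact Finset.ne_of_mem_erase hj
    obtain ⟨g, hg, hsum⟩ := ih (Function.update f i y) (by
      have hfi := hrest (f i)
      rw [Function.update_eq_self] at hfi
      rw [hrest y, hfi, Multiset.erase_cons_head, add_comm, Multiset.singleton_add])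
    refine ⟨g, hg, ?_⟩
    rw [← Finset.add_sum_erase _ _ (Finset.mem_univ i)] at hsum ⊢
    have hcongr : ∑ j ∈ Finset.univ.erase i, distM E w (Function.update f i y j) (g j) =
        ∑ j ∈ Finset.univ.erase i, distM E w (f j) (g j) :=
      Finset.sum_congr rfl fun j hj => by
        rw [Function.update_of_ne (Finset.ne_of_mem_erase hj)]
    rw [hcongr, Function.update_self] at hsum
    calc _ ≤ ((w (f i) y : ℕ∞) + distM E w y (g i)) + _ :=
          add_le_add_left (distM_le_add_of_edge w hxy (g i)) _
      _ ≤ (w (f i) y : ℕ∞) + c := by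
          rw [add_assoc]
          exact add_le_add_right hsum _
      _ = _ := by push_cast; rfl

end Reach

theorem exists_embedding_comp_eq_of_map_le {ι κ V : Type*} [Fintype ι] [Fintype κ]
    {f : ι → V} {g : κ → V} (h : Finset.univ.val.map f ≤ Finset.univ.val.map g) :
    ∃ σ : ι ↪ κ, ∀ i, g (σ i) = f i := by
  classical
  have hfib (v : V) : Nonempty ({i // f i = v} ↪ {j // g j = v}) := by
    rw [Function.Embedding.nonempty_iff_card_le, Fintype.card_subtype, Fintype.card_subtype]
    simpa [Multiset.count_map, Finset.card_def, eq_comm] using Multiset.count_le_of_le v h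
  have e (v : V) : {i // f i = v} ↪ {j // g j = v} := (hfib v).some
  refine ⟨⟨fun i => e (f i) ⟨i, rfl⟩, fun i j hij => ?_⟩, fun i => (e (f i) ⟨i, rfl⟩).2⟩
  have hf : f i = f j := by
    rw [← (e (f i) ⟨i, rfl⟩).2, ← (e (f j) ⟨j, rfl⟩).2]
    exact congrArg g hij
  have hinj : ∀ v (hi : f i = v) (hj : f j = v), (e v ⟨i, hi⟩ : κ) = e v ⟨j, hj⟩ → i = j :=
    fun v hi hj he => congrArg Subtype.val ((e v).injective (Subtype.ext he))
  refine hinj (f j) hf rfl ?_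
  have hmove : ∀ v (hv : f i = v), (e (f i) ⟨i, rfl⟩ : κ) = e v ⟨i, hv⟩ := by
    rintro _ rfl
    rfl
  exact (hmove _ hf).symm.trans hij

/-- A target configuration `t_1, …, t_m` can be covered from the initial configuration
`s_1, …, s_k` (with `m ≤ k`) within movement budget `b` if and only if there is an
injective assignment `σ` of target positions to tokens with
`∑ i, dist_M(s_{σ i}, t_i) ≤ b`. -/
theorem reach_target_iff_injective_assignment
    {V : Type*} [Fintype V] [DecidableEq V] (E : V → V → Prop) (w : V → V → ℕ)
    (k m : ℕ) (hm : m ≤ k) (s : Fin k → V) (t : Fin m → V) (b : ℕ) :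
    (∃ (S' : Multiset V) (c : ℕ),
        Reach E w (Multiset.map s Finset.univ.val) c S' ∧ c ≤ b ∧
        Multiset.map t Finset.univ.val ≤ S') ↔
    (∃ σ : Fin m ↪ Fin k, ∑ i : Fin m, distM E w (s (σ i)) (t i) ≤ (b : ℕ∞)) := by
  constructor
  · rintro ⟨S', c, hreach, hc, hT⟩
    obtain ⟨g, rfl, hsum⟩ := hreach.exists_map_eq s rfl
    obtain ⟨σ, hσ⟩ := exists_embedding_comp_eq_of_map_le hT
    refine ⟨σ, ?_⟩
    calc ∑ i, distM E w (s (σ i)) (t i)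
        = ∑ j ∈ Finset.univ.map σ, distM E w (s j) (g j) := by simp [hσ]
      _ ≤ ∑ j, distM E w (s j) (g j) :=
          Finset.sum_le_sum_of_subset (Finset.subset_univ _)
      _ ≤ (c : ℕ∞) := hsum
      _ ≤ (b : ℕ∞) := by exact_mod_cast hc
  · rintro ⟨σ, hσ⟩
    have hfin (i : Fin m) : distM E w (s (σ i)) (t i) ≠ ⊤ := fun htop =>
      ENat.natCast_ne_top b (top_le_iff.1 (htop ▸
        (Finset.single_le_sum (f := fun i => distM E w (s (σ i)) (t i))
          (fun _ _ => zero_le) (Finset.mem_univ i)).trans hσ))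
    choose c hc hmove using fun i => Reach.exists_of_distM_ne_top (hfin i)
    have hle : Finset.univ.val.map (fun i => s (σ i)) ≤ Finset.univ.val.map s := by
      rw [← Function.comp_def, ← Multiset.map_map]
      refine Multiset.map_le_map ?_
      exact Finset.val_le_iff.2 (Finset.subset_univ (Finset.univ.map σ))
    have hreach := Reach.map_add _ t c hmove Finset.univ
      (Finset.univ.val.map s - Finset.univ.val.map (fun i => s (σ i)))
    rw [add_tsub_cancel_of_le hle] at hreach
    refine ⟨_, _, hreach, ?_, Multiset.le_add_right _ _⟩
    simp only [hc] at hσ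
    exact_mod_cast hσ
end
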